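/- Let β ∈ {1,2,4} and n ≥ 1 an integer, and set b := 3βn/2 + 2 − β. Then the mean of the Wigner delay time equals 1: (1/Z) · ∫_{(0,∞)^n} ((1/n)∑_{j=1}^n τ_j) · ∏_{j=1}^n τ_j^{−b} e^{−βn/(2τ_j)} · ∏_{1≤j<k≤n} |τ_k−τ_j|^β dτ_1⋯dτ_n = 1, where Z := ∫_{(0,∞)^n} ∏_{j=1}^n τ_j^{−b} e^{−βn/(2τ_j)} ∏_{1≤j<k≤n} |τ_k−τ_j|^β dτ_1⋯dτ_n. -/

import Mathlib

open MeasureTheory Finset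

/-- The β-deformed Vandermonde interaction factor `∏_{j<k} |τ_k - τ_j|^β`. -/
noncomputable def vand (β : ℝ) {n : ℕ} (T : Fin n → ℝ) : ℝ :=
  ∏ j, ∏ k ∈ Finset.Ioi j, |T k - T j| ^ β

/-- The (unnormalized) joint density `∏_j τ_j^{-b} e^{-βn/(2τ_j)} ∏_{j<k}|τ_k-τ_j|^β`
of the proper delay times. -/
noncomputable def wdW (β b : ℝ) (n : ℕ) (τ : Fin n → ℝ) : ℝ :=
  (∏ j, τ j ^ (-b) * Real.exp (-(β * n / (2 * τ j)))) * vand β τ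

/-- Expectation of an observable with respect to the proper delay time density. -/
noncomputable def wdE (β b : ℝ) (n : ℕ) (f : (Fin n → ℝ) → ℝ) : ℝ :=
  (∫ τ in Set.univ.pi (fun _ : Fin n => Set.Ioi (0 : ℝ)), f τ * wdW β b n τ) /
    ∫ τ in Set.univ.pi (fun _ : Fin n => Set.Ioi (0 : ℝ)), wdW β b n τ

section LineDeriv

variable {E : Type*} [NormedAddCommGroup E] [NormedSpace ℝ E] [MeasurableSpace E] [BorelSpace E]

/-- If `G` is, off a countable set on each line, the derivative of `F` in the direction `v`, and
both are integrable for a translation invariant measure, then the integral of `G` vanishes. -/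
theorem integral_eq_zero_of_hasDerivAt_line_off_countable {μ : Measure E} [SFinite μ]
    [μ.IsAddRightInvariant] {F G : E → ℝ} (v : E) (hF : Integrable F μ) (hG : Integrable G μ)
    (hGm : Measurable G) (hFc : Continuous F)
    (hFG : ∀ x, ∃ s : Set ℝ, s.Countable ∧
      ∀ t ∉ s, HasDerivAt (fun t : ℝ => F (x + t • v)) (G (x + t • v)) t) :
    ∫ x, G x ∂μ = 0 := by
  have hprod : Integrable (fun p : E × ℝ => G (p.1 + p.2 • v))
      (μ.prod (volume.restrict (Set.Ioc (0 : ℝ) 1))) := by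
    have hm : Measurable fun p : E × ℝ => G (p.1 + p.2 • v) :=
      hGm.comp (by fun_prop : Continuous fun p : E × ℝ => p.1 + p.2 • v).measurable
    rw [integrable_prod_iff' hm.aestronglyMeasurable]
    refine ⟨ae_of_all _ fun t => hG.comp_add_right (t • v), ?_⟩
    simp only [integral_add_right_eq_self (fun x => ‖G x‖)]
    exact integrable_const _
  have hFTC : ∀ᵐ x ∂μ, ∫ t in Set.Ioc (0 : ℝ) 1, G (x + t • v) = F (x + v) - F x := by
    filter_upwards [hprod.prod_right_ae] with x hx
    obtain ⟨s, hs, hd⟩ := hFG x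
    rw [← intervalIntegral.integral_of_le zero_le_one,
      integral_eq_of_hasDerivAt_off_countable_of_le
        (fun t : ℝ => F (x + t • v)) _ zero_le_one hs
        (by fun_prop) (fun t ht => hd t ht.2)
        ((intervalIntegrable_iff_integrableOn_Ioc_of_le zero_le_one).2 hx)]
    simp
  have hswap := integral_integral_swap (f := fun (x : E) (t : ℝ) => G (x + t • v)) hprod
  simp only [integral_add_right_eq_self G] at hswap
  rw [integral_congr_ae hFTC, integral_sub (hF.comp_add_right v) hF,
    integral_add_right_eq_self F] at hswap
  simpa using hswap.symm

end LineDeriv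

section Inversion

theorem abs_inv_sub_inv_rpow {x y : ℝ} (hx : 0 < x) (hy : 0 < y) (β : ℝ) :
    |x⁻¹ - y⁻¹| ^ β = |x - y| ^ β * (x ^ (-β) * y ^ (-β)) := by
  rw [inv_sub_inv hx.ne' hy.ne', abs_div, abs_sub_comm, abs_of_pos (mul_pos hx hy),
    Real.div_rpow (abs_nonneg _) (by positivity), Real.mul_rpow hx.le hy.le,
    Real.rpow_neg hx.le, Real.rpow_neg hy.le]
  field_simp

theorem vand_inv (β : ℝ) {n : ℕ} {x : Fin n → ℝ} (hx : ∀ j, 0 < x j) :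
    vand β (fun j => (x j)⁻¹) = vand β x * ∏ j, x j ^ (-(β * (n - 1))) := by
  have hpair : ∏ j, ∏ k ∈ Ioi j, x k ^ (-β) * x j ^ (-β) = ∏ j, x j ^ (-(β * (n - 1))) := by
    rw [prod_prod_Ioi_mul_eq_prod_prod_off_diag (fun k _ => x k ^ (-β)),
      prod_comm' (t' := univ) (s' := fun k => {k}ᶜ)]
    · refine prod_congr rfl fun k _ => ?_
      rw [prod_const, card_compl, Fintype.card_fin, card_singleton,
        ← Real.rpow_mul_natCast (hx k).le, Nat.cast_sub (k.pos)]
      congr 1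
      push_cast
      ring
    · simp [eq_comm]
  simp only [vand, abs_inv_sub_inv_rpow (hx _) (hx _), prod_mul_distrib (g := fun _ => _ * _)]
  rw [← hpair]
  simp only [prod_mul_distrib]

theorem setIntegral_pi_Ioi_inv {ι : Type*} [Fintype ι] (f : (ι → ℝ) → ℝ) :
    ∫ x in Set.univ.pi (fun _ : ι => Set.Ioi (0 : ℝ)), f x =
      ∫ x in Set.univ.pi (fun _ : ι => Set.Ioi (0 : ℝ)),
        (∏ j, x j ^ (-2 : ℝ)) * f (fun j => (x j)⁻¹) := by
  set S := Set.univ.pi (fun _ : ι => Set.Ioi (0 : ℝ)) with hS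
  have hmeas : MeasurableSet S := MeasurableSet.univ_pi fun _ => measurableSet_Ioi
  have hinv : Set.MapsTo (fun (x : ι → ℝ) j => (x j)⁻¹) S S := fun x hx j _ =>
    Set.mem_Ioi.2 (inv_pos.2 (hx j trivial))
  have himage : (fun (x : ι → ℝ) j => (x j)⁻¹) '' S = S :=
    (Set.image_subset_iff.2 hinv).antisymm fun x hx => ⟨_, hinv hx, by simp⟩
  have hinj : Set.InjOn (fun (x : ι → ℝ) j => (x j)⁻¹) S := fun x _ y _ h =>
    funext fun j => inv_injective (congrFun h j)
  have hderiv : ∀ x ∈ S, HasFDerivWithinAt (fun (x : ι → ℝ) j => (x j)⁻¹)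
      (ContinuousLinearMap.pi fun j =>
        (ContinuousLinearMap.toSpanSingleton ℝ (-(x j ^ 2)⁻¹)).comp
          (ContinuousLinearMap.proj j)) S x := by
    intro x hx
    rw [hasFDerivWithinAt_pi]
    intro j
    exact ((hasDerivAt_inv (ne_of_gt (hx j trivial))).hasFDerivAt.comp x
      (hasFDerivAt_apply j x)).hasFDerivWithinAt
  conv_lhs => rw [← himage]
  rw [integral_image_eq_integral_abs_det_fderiv_smul volume hmeas hderiv hinj]
  refine setIntegral_congr_fun hmeas fun x hx => ?_
  have hdet : ∏ j, |(ContinuousLinearMap.toSpanSingleton ℝ (-(x j ^ 2)⁻¹)).det| =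
      ∏ j, x j ^ (-2 : ℝ) := by
    refine prod_congr rfl fun j _ => ?_
    have hj : 0 < x j := hx j trivial
    rw [Real.rpow_neg hj.le, Real.rpow_two]
    simp [ContinuousLinearMap.det, LinearMap.det_ring]
  simp only [ContinuousLinearMap.det_pi, abs_prod, hdet, smul_eq_mul]

end Inversion

section Laguerre

/-- The gamma weight `x ^ a * exp (-c x)` on `(0, ∞)`, extended by zero. -/
noncomputable def gammaWeight (a c x : ℝ) : ℝ := max x 0 ^ a * Real.exp (-(c * x))

/-- The unnormalized density of the `β`-Laguerre ensemble. -/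
noncomputable def laguerreWeight (β a c : ℝ) {n : ℕ} (x : Fin n → ℝ) : ℝ :=
  (∏ j, gammaWeight a c (x j)) * vand β x

theorem gammaWeight_of_nonpos {a c x : ℝ} (ha : 0 < a) (hx : x ≤ 0) : gammaWeight a c x = 0 := by
  simp [gammaWeight, max_eq_right hx, Real.zero_rpow ha.ne']

theorem gammaWeight_nonneg (a c x : ℝ) : 0 ≤ gammaWeight a c x := by
  unfold gammaWeight; positivity

theorem continuous_gammaWeight {a : ℝ} (ha : 0 ≤ a) (c : ℝ) : Continuous (gammaWeight a c) := by
  unfold gammaWeight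
  exact ((continuous_id.max continuous_const).rpow_const fun _ => Or.inr ha).mul (by fun_prop)

theorem hasDerivAt_gammaWeight {a : ℝ} (ha : 0 < a) (c : ℝ) {x : ℝ} (hx : x ≠ 0) :
    HasDerivAt (gammaWeight a c) ((a * x⁻¹ - c) * gammaWeight a c x) x := by
  rcases hx.lt_or_gt with h | h
  · rw [gammaWeight_of_nonpos ha h.le, mul_zero]
    refine (hasDerivAt_const x (0 : ℝ)).congr_of_eventuallyEq ?_
    filter_upwards [Iio_mem_nhds h] with y hy
    exact gammaWeight_of_nonpos ha (le_of_lt hy)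
  · have h1 : HasDerivAt (fun y : ℝ => y ^ a * Real.exp (-(c * y)))
        ((a * x⁻¹ - c) * gammaWeight a c x) x := by
      convert! (Real.hasDerivAt_rpow_const (p := a) (Or.inl hx)).mul
        ((((hasDerivAt_id x).const_mul c).neg).exp) using 1
      simp only [gammaWeight, max_eq_left h.le, Real.rpow_sub_one hx, Pi.neg_apply, id]
      field_simp
      ring
    refine h1.congr_of_eventuallyEq ?_
    filter_upwards [Ioi_mem_nhds h] with y hy
    simp [gammaWeight, max_eq_left (le_of_lt (Set.mem_Ioi.1 hy))]

theorem integrableOn_rpow_mul_exp_mul_pow {s c : ℝ} (hs : -1 < s) (hc : 0 < c) (M : ℕ) :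
    IntegrableOn (fun x : ℝ => x ^ s * Real.exp (-(c * x)) * (1 + |x|) ^ M) (Set.Ioi 0) := by
  have key : ∀ {r : ℝ}, -1 < r →
      IntegrableOn (fun x : ℝ => x ^ r * Real.exp (-(c * x))) (Set.Ioi 0) := fun {r} hr => by
    simpa using integrableOn_rpow_mul_exp_neg_mul_rpow hr one_pos hc
  have hdom := ((key hs).add
    (key (r := s + M) (by have := M.cast_nonneg (α := ℝ); linarith))).const_mul (2 ^ (M - 1) : ℝ)
  refine hdom.mono' (by fun_prop) ?_
  filter_upwards [ae_restrict_mem measurableSet_Ioi] with x hx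
  have hx : 0 < x := hx
  have h1 : (1 + x) ^ M ≤ 2 ^ (M - 1) * (1 ^ M + x ^ M) := add_pow_le zero_le_one hx.le M
  rw [Real.norm_of_nonneg (by positivity), abs_of_pos hx]
  calc x ^ s * Real.exp (-(c * x)) * (1 + x) ^ M
      ≤ x ^ s * Real.exp (-(c * x)) * (2 ^ (M - 1) * (1 ^ M + x ^ M)) := by gcongr
    _ = _ := by simp [Real.rpow_add hx, Real.rpow_natCast]; ring

theorem integrable_gammaWeight_mul_pow {a c : ℝ} (ha : 0 < a) (hc : 0 < c) (M : ℕ) :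
    Integrable fun x => gammaWeight a c x * (1 + |x|) ^ M := by
  rw [← integrableOn_iff_integrable_of_support_subset (s := Set.Ioi 0)]
  · refine (integrableOn_rpow_mul_exp_mul_pow (by linarith) hc M).congr_fun (s := Set.Ioi 0)
      (f := fun x : ℝ => x ^ a * Real.exp (-(c * x)) * (1 + |x|) ^ M) (fun x hx => ?_)
      measurableSet_Ioi
    simp [gammaWeight, max_eq_left (le_of_lt (Set.mem_Ioi.1 hx))]
  · intro x hx
    by_contra h
    exact hx (by simp [gammaWeight_of_nonpos ha (not_lt.1 h)])

theorem integrable_inv_mul_gammaWeight_mul_pow {a c : ℝ} (ha : 0 < a) (hc : 0 < c) (M : ℕ) :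
    Integrable fun x => x⁻¹ * gammaWeight a c x * (1 + |x|) ^ M := by
  rw [← integrableOn_iff_integrable_of_support_subset (s := Set.Ioi 0)]
  · refine (integrableOn_rpow_mul_exp_mul_pow (s := a - 1) (by linarith) hc M).congr_fun
      (fun x hx => ?_) measurableSet_Ioi
    have hx : 0 < x := hx
    simp only [gammaWeight, max_eq_left hx.le, Real.rpow_sub_one hx.ne']
    ring
  · intro x hx
    by_contra h
    exact hx (by simp [gammaWeight_of_nonpos ha (not_lt.1 h)])

theorem vand_nonneg (β : ℝ) {n : ℕ} (x : Fin n → ℝ) : 0 ≤ vand β x := by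
  unfold vand; positivity

theorem continuous_vand {β : ℝ} (hβ : 0 ≤ β) {n : ℕ} :
    Continuous (vand β : (Fin n → ℝ) → ℝ) := by
  unfold vand
  refine continuous_finsetProd _ fun j _ => continuous_finsetProd _ fun k _ => ?_
  exact Continuous.rpow_const (by fun_prop) fun _ => Or.inr hβ

theorem vand_add_const (β : ℝ) {n : ℕ} (x : Fin n → ℝ) (t : ℝ) :
    vand β (fun j => x j + t) = vand β x := by
  simp [vand]

theorem exists_vand_le_prod_pow {β : ℝ} (hβ : 0 ≤ β) (n : ℕ) :
    ∃ M : ℕ, ∀ x : Fin n → ℝ, vand β x ≤ ∏ j, (1 + |x j|) ^ M := by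
  obtain ⟨K, hK⟩ := exists_nat_ge β
  refine ⟨∑ j : Fin n, ∑ _k ∈ Ioi j, 2 * K, fun x => ?_⟩
  set P := ∏ j, (1 + |x j|)
  have hP : ∀ j, 1 + |x j| ≤ P := fun j => by
    rw [show P = _ from (mul_prod_erase _ _ (mem_univ j)).symm]
    exact le_mul_of_one_le_right (by positivity)
      (Finset.one_le_prod fun i _ => by linarith [abs_nonneg (x i)])
  rw [prod_pow, ← prod_pow_eq_pow_sum]
  simp only [← prod_pow_eq_pow_sum]
  unfold vand
  refine prod_le_prod (fun _ _ => by positivity) fun j _ =>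
    prod_le_prod (fun _ _ => by positivity) fun k _ => ?_
  have hP1 : 1 ≤ P := by linarith [hP j, abs_nonneg (x j)]
  have hd : |x k - x j| ≤ P ^ 2 := by
    nlinarith [abs_sub (x k) (x j), hP j, hP k, abs_nonneg (x j), abs_nonneg (x k)]
  calc |x k - x j| ^ β ≤ (P ^ 2) ^ β := Real.rpow_le_rpow (abs_nonneg _) hd hβ
    _ ≤ (P ^ 2) ^ (K : ℝ) := Real.rpow_le_rpow_of_exponent_le (one_le_pow₀ hP1) hK
    _ = P ^ (2 * K) := by rw [Real.rpow_natCast, pow_mul]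

theorem integrable_prod_mul_vand {β : ℝ} (hβ : 0 ≤ β) {n : ℕ} {g : Fin n → ℝ → ℝ}
    (hgm : ∀ j, Measurable (g j))
    (hg : ∀ j (M : ℕ), Integrable fun x => g j x * (1 + |x|) ^ M) :
    Integrable fun x : Fin n → ℝ => (∏ j, g j (x j)) * vand β x := by
  obtain ⟨M, hM⟩ := exists_vand_le_prod_pow hβ n
  have hdom := (Integrable.fintype_prod fun j => hg j M).norm
  refine hdom.mono' ?_ (ae_of_all _ fun x => ?_)
  · have := (continuous_vand hβ (n := n)).measurable
    exact Measurable.aestronglyMeasurable (by fun_prop)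
  · rw [norm_mul, Real.norm_of_nonneg (vand_nonneg β x), prod_mul_distrib, norm_mul]
    gcongr
    exact (hM x).trans (le_abs_self _)

variable {β a c : ℝ} {n : ℕ}

theorem continuous_laguerreWeight (hβ : 0 ≤ β) (ha : 0 ≤ a) :
    Continuous (laguerreWeight β a c : (Fin n → ℝ) → ℝ) := by
  have h1 := continuous_gammaWeight ha c
  have h2 := continuous_vand hβ (n := n)
  unfold laguerreWeight
  fun_prop

theorem laguerreWeight_nonneg (x : Fin n → ℝ) : 0 ≤ laguerreWeight β a c x :=
  mul_nonneg (prod_nonneg fun _ _ => gammaWeight_nonneg _ _ _) (vand_nonneg _ _)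

theorem laguerreWeight_of_nonpos (ha : 0 < a) {x : Fin n → ℝ} {j : Fin n} (hj : x j ≤ 0) :
    laguerreWeight β a c x = 0 := by
  rw [laguerreWeight, prod_eq_zero (mem_univ j) (gammaWeight_of_nonpos ha hj), zero_mul]

theorem laguerreWeight_add_smul (x : Fin n → ℝ) (t : ℝ) :
    laguerreWeight β a c (x + t • fun _ => 1) =
      (∏ j, gammaWeight a c (x j + t)) * vand β x := by
  rw [← vand_add_const β x t]
  simp [laguerreWeight, Pi.add_def]

theorem integrable_laguerreWeight (hβ : 0 ≤ β) (ha : 0 < a) (hc : 0 < c) :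
    Integrable (laguerreWeight β a c : (Fin n → ℝ) → ℝ) :=
  integrable_prod_mul_vand hβ (fun _ => (continuous_gammaWeight ha.le c).measurable)
    fun _ => integrable_gammaWeight_mul_pow ha hc

theorem integrable_inv_mul_laguerreWeight (hβ : 0 ≤ β) (ha : 0 < a) (hc : 0 < c) (i : Fin n) :
    Integrable fun x : Fin n → ℝ => (x i)⁻¹ * laguerreWeight β a c x := by
  have hm := (continuous_gammaWeight ha.le c).measurable
  have h := integrable_prod_mul_vand hβ
    (g := Function.update (fun _ => gammaWeight a c) i fun x => x⁻¹ * gammaWeight a c x)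
    (fun j => by
      rcases eq_or_ne j i with rfl | h
      · simpa [Pi.mul_def] using measurable_inv.mul hm
      · simpa [h] using hm)
    (fun j M => by
      rcases eq_or_ne j i with rfl | h
      · simpa using integrable_inv_mul_gammaWeight_mul_pow ha hc M
      · simpa [h] using integrable_gammaWeight_mul_pow ha hc M)
  convert h using 2 with x
  rw [laguerreWeight, ← mul_assoc, ← mul_prod_erase _ _ (mem_univ i),
    ← mul_prod_erase _ (fun j => Function.update (fun _ => gammaWeight a c) i
      (fun x => x⁻¹ * gammaWeight a c x) j (x j)) (mem_univ i), ← mul_assoc]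
  congr 2
  · simp
  · exact prod_congr rfl fun j hj => by simp [ne_of_mem_erase hj]

theorem integral_laguerreWeight_pos (hβ : 0 ≤ β) (ha : 0 < a) (hc : 0 < c) :
    0 < ∫ x : Fin n → ℝ, laguerreWeight β a c x := by
  refine integral_pos_of_integrable_nonneg_nonzero (x := fun j => (j : ℝ) + 1)
    (continuous_laguerreWeight hβ ha.le) (integrable_laguerreWeight hβ ha hc)
    laguerreWeight_nonneg (ne_of_gt ?_)
  refine mul_pos (prod_pos fun j _ => ?_) (prod_pos fun j _ => prod_pos fun k hk => ?_)
  · have : (0 : ℝ) < (j : ℝ) + 1 := by positivity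
    rw [gammaWeight, max_eq_left this.le]
    positivity
  · refine Real.rpow_pos_of_pos (abs_pos.2 ?_) _
    have : (j : ℝ) < k := by exact_mod_cast mem_Ioi.1 hk
    linarith

theorem integral_sum_inv_mul_laguerreWeight (hβ : 0 ≤ β) (ha : 0 < a) (hc : 0 < c) :
    a * ∫ x : Fin n → ℝ, (∑ j, (x j)⁻¹) * laguerreWeight β a c x =
      c * n * ∫ x : Fin n → ℝ, laguerreWeight β a c x := by
  have hW := integrable_laguerreWeight (n := n) hβ ha hc
  have hI : Integrable fun x : Fin n → ℝ => (∑ j, (x j)⁻¹) * laguerreWeight β a c x := by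
    simp only [sum_mul]
    exact integrable_finsetSum _ fun i _ => integrable_inv_mul_laguerreWeight hβ ha hc i
  have hcont := continuous_laguerreWeight (c := c) (n := n) hβ ha.le
  have hmeas := hcont.measurable
  have hzero := integral_eq_zero_of_hasDerivAt_line_off_countable (μ := volume)
    (F := laguerreWeight β a c) (fun _ : Fin n => (1 : ℝ)) hW
    ((hI.const_mul a).sub (hW.const_mul (c * n))) (by fun_prop) hcont
    fun x => ⟨Set.range fun j => -x j, Set.countable_range _, fun t ht => by
      have hne : ∀ j, x j + t ≠ 0 := fun j h => ht ⟨j, by linarith⟩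
      have hd := (HasDerivAt.fun_finsetProd (u := univ) fun j _ =>
        (hasDerivAt_gammaWeight ha c (hne j)).comp t ((hasDerivAt_id t).const_add (x j))).mul_const
          (vand β x)
      convert! hd using 1
      · simp only [laguerreWeight_add_smul, Function.comp_def]
      · have hterm : ∀ j, (∏ k ∈ univ.erase j, gammaWeight a c (x k + t)) *
            ((a * (x j + t)⁻¹ - c) * gammaWeight a c (x j + t)) =
            (a * (x j + t)⁻¹ - c) * ∏ k, gammaWeight a c (x k + t) := fun j => by
          rw [← mul_prod_erase _ _ (mem_univ j)]; ring
        simp [laguerreWeight_add_smul, hterm, ← sum_mul, sum_sub_distrib, ← mul_sum]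
        ring⟩
  simp only [Pi.sub_apply] at hzero
  rw [integral_sub (hI.const_mul a) (hW.const_mul _), integral_const_mul,
    integral_const_mul] at hzero
  linarith

end Laguerre

theorem setIntegral_mul_wdW {β : ℝ} (hβ : 0 < β) {n : ℕ} (hn : 1 ≤ n) (f : (Fin n → ℝ) → ℝ) :
    ∫ τ in Set.univ.pi (fun _ : Fin n => Set.Ioi (0 : ℝ)),
        f τ * wdW β (3 * β * n / 2 + 2 - β) n τ =
      ∫ x : Fin n → ℝ, f (fun j => (x j)⁻¹) * laguerreWeight β (β * n / 2) (β * n / 2) x := by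
  have ha : 0 < β * n / 2 := by positivity
  rw [setIntegral_pi_Ioi_inv, ← setIntegral_eq_integral_of_forall_compl_eq_zero
    (s := Set.univ.pi (fun _ : Fin n => Set.Ioi (0 : ℝ)))
    (f := fun x => f (fun j => (x j)⁻¹) * laguerreWeight β (β * n / 2) (β * n / 2) x)]
  · refine setIntegral_congr_fun (MeasurableSet.univ_pi fun _ => measurableSet_Ioi) fun x hx => ?_
    have hpos : ∀ j, 0 < x j := fun j => hx j trivial
    simp only [wdW, laguerreWeight, vand_inv β hpos]
    have hfac : ∀ j, gammaWeight (β * n / 2) (β * n / 2) (x j) =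
        x j ^ (-2 : ℝ) * ((x j)⁻¹ ^ (-(3 * β * n / 2 + 2 - β)) *
          Real.exp (-(β * n / (2 * (x j)⁻¹)))) * x j ^ (-(β * (n - 1))) := fun j => by
      have hj := hpos j
      rw [gammaWeight, max_eq_left hj.le, Real.inv_rpow hj.le, ← Real.rpow_neg hj.le]
      have hexp : β * n / (2 * (x j)⁻¹) = β * n / 2 * x j := by field_simp
      rw [hexp, mul_right_comm, ← mul_assoc, mul_right_comm _ _ (x j ^ _),
        ← Real.rpow_add hj, ← Real.rpow_add hj]
      ring_nf
    simp only [hfac, prod_mul_distrib]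
    ring
  · intro x hx
    obtain ⟨j, hj⟩ : ∃ j, x j ≤ 0 := by simpa [Set.mem_pi] using hx
    rw [laguerreWeight_of_nonpos ha hj, mul_zero]

/-- The mean of the Wigner delay time equals 1, for `β ∈ {1,2,4}`. -/
theorem wigner_delay_time_mean
    (β : ℝ) (hβ : β = 1 ∨ β = 2 ∨ β = 4) (n : ℕ) (hn : 1 ≤ n)
    (b : ℝ) (hb : b = 3 * β * n / 2 + 2 - β) :
    wdE β b n (fun τ => (1 / (n : ℝ)) * ∑ j, τ j) = 1 := by
  have hβ0 : 0 < β := by rcases hβ with rfl | rfl | rfl <;> norm_num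
  have ha : 0 < β * n / 2 := by positivity
  have hZ := integral_laguerreWeight_pos (n := n) hβ0.le ha ha
  have hmean := integral_sum_inv_mul_laguerreWeight (n := n) hβ0.le ha ha
  have hone := setIntegral_mul_wdW hβ0 hn fun _ => 1
  simp only [one_mul] at hone
  subst hb
  rw [wdE, setIntegral_mul_wdW hβ0 hn, hone, div_eq_one_iff_eq hZ.ne']
  simp only [mul_assoc (1 / (n : ℝ))]
  rw [mul_assoc, mul_right_inj' ha.ne'] at hmean
  rw [integral_const_mul, hmean]
  field_simp
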